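/- For any MCS Δ0 containing K_x y = T_y, K_y x = T_x, x ≡ c_x, y ≡ c_y (with T_y ∪ T_x ∪ {c_x,c_y} ⊆ Cons), the induced canonical model M^{Δ0} = (D, I, Σ, ∼) is a k-sight model: all components are well-defined (independent of choice of representatives), I(R) is serial, ∼_x and ∼_y are equivalence relations on Σ, and whenever Δ1 ∼_z Δ2 and Δ1(z') ∈ D^k(Δ1(z)) for z' ∈ Var, then Δ1(z') = Δ2(z'). -/

import Mathlib

/-! Core definitions for the Epistemic Logic of Cops and Robbers (ELCR). -/

/-- The two players/variables. -/
inductive Var : Type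
  | x | y
  deriving DecidableEq

/-- The other variable. -/
def Var.other : Var → Var
  | .x => .y
  | .y => .x

/-- Terms: constants or variables. -/
inductive Term (Cons : Type) : Type
  | const (c : Cons)
  | var (v : Var)
  deriving DecidableEq

/-- Formulas of the full language `L` (with movement modalities). -/
inductive Form (Pred Cons : Type) : Type
  | pred (P : Pred) (args : List (Term Cons))
  | rel (t₁ t₂ : Term Cons)
  | eq (t₁ t₂ : Term Cons)
  | neg (φ : Form Pred Cons)
  | and (φ ψ : Form Pred Cons)
  | Kt (z : Var) (t : Term Cons)
  | K (z : Var) (φ : Form Pred Cons)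
  | box (z : Var) (φ : Form Pred Cons)

namespace Form

variable {Pred Cons : Type}

def imp (φ ψ : Form Pred Cons) : Form Pred Cons := .neg (.and φ (.neg ψ))
def or (φ ψ : Form Pred Cons) : Form Pred Cons := .neg (.and (.neg φ) (.neg ψ))
def iffF (φ ψ : Form Pred Cons) : Form Pred Cons := .and (imp φ ψ) (imp ψ φ)
def falseF : Form Pred Cons := .neg (.eq (.var .x) (.var .x))
def trueF : Form Pred Cons := .neg falseF
/-- `⟨K_z⟩φ := ¬K_z¬φ`. -/
def diaK (z : Var) (φ : Form Pred Cons) : Form Pred Cons := .neg (.K z (.neg φ))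

def bigAnd : List (Form Pred Cons) → Form Pred Cons
  | [] => trueF
  | φ :: l => .and φ (bigAnd l)

def bigOr : List (Form Pred Cons) → Form Pred Cons
  | [] => falseF
  | φ :: l => or φ (bigOr l)

/-- Membership in the Boolean base language `L_B`. -/
def isBase : Form Pred Cons → Prop
  | .pred _ _ => True
  | .rel _ _ => True
  | .eq _ _ => True
  | .neg φ => isBase φ
  | .and φ ψ => isBase φ ∧ isBase ψ
  | .Kt _ _ => False
  | .K _ _ => False
  | .box _ _ => False

/-- Membership in `L_BD` (Booleans plus movement modalities). -/
def isBD : Form Pred Cons → Prop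
  | .pred _ _ => True
  | .rel _ _ => True
  | .eq _ _ => True
  | .neg φ => isBD φ
  | .and φ ψ => isBD φ ∧ isBD ψ
  | .Kt _ _ => False
  | .K _ _ => False
  | .box _ φ => isBD φ

/-- Membership in the full language `L`. -/
def isL : Form Pred Cons → Prop
  | .pred _ _ => True
  | .rel _ _ => True
  | .eq _ _ => True
  | .neg φ => isL φ
  | .and φ ψ => isL φ ∧ isL ψ
  | .Kt _ _ => True
  | .K _ ψ => isBD ψ
  | .box _ φ => isL φ

/-- Membership in the static fragment `L⁻`: no movement modalities, and the
knowledge operator `K_z` is applied to `L_B`-formulas only. -/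
def isStatic : Form Pred Cons → Prop
  | .pred _ _ => True
  | .rel _ _ => True
  | .eq _ _ => True
  | .neg φ => isStatic φ
  | .and φ ψ => isStatic φ ∧ isStatic ψ
  | .Kt _ _ => True
  | .K _ φ => isBase φ
  | .box _ _ => False

/-- The variable `z` occurs in the formula. -/
def occurs (z : Var) : Form Pred Cons → Prop
  | .pred _ args => Term.var z ∈ args
  | .rel t₁ t₂ => t₁ = Term.var z ∨ t₂ = Term.var z
  | .eq t₁ t₂ => t₁ = Term.var z ∨ t₂ = Term.var z
  | .neg φ => occurs z φ
  | .and φ ψ => occurs z φ ∨ occurs z ψ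
  | .Kt w t => w = z ∨ t = Term.var z
  | .K w φ => w = z ∨ occurs z φ
  | .box w φ => w = z ∨ occurs z φ

/-- The list of terms occurring in a formula. -/
def termList : Form Pred Cons → List (Term Cons)
  | .pred _ args => args
  | .rel t₁ t₂ => [t₁, t₂]
  | .eq t₁ t₂ => [t₁, t₂]
  | .neg φ => termList φ
  | .and φ ψ => termList φ ++ termList ψ
  | .Kt _ t => [t]
  | .K _ φ => termList φ
  | .box _ φ => termList φ

end Form

/-- Substituting the constant `c` for the variable `z` in a term. -/
def Term.substC {Cons : Type} (c : Cons) (z : Var) : Term Cons → Term Cons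
  | .var v => if v = z then .const c else .var v
  | .const c' => .const c'

/-- `φ.substC c z` is `φ[c/z]`. -/
def Form.substC {Pred Cons : Type} (c : Cons) (z : Var) : Form Pred Cons → Form Pred Cons
  | .pred P args => .pred P (args.map (Term.substC c z))
  | .rel t₁ t₂ => .rel (t₁.substC c z) (t₂.substC c z)
  | .eq t₁ t₂ => .eq (t₁.substC c z) (t₂.substC c z)
  | .neg φ => .neg (φ.substC c z)
  | .and φ ψ => .and (φ.substC c z) (ψ.substC c z)
  | .Kt w t => .Kt w (t.substC c z)
  | .K w φ => .K w (φ.substC c z)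
  | .box w φ => .box w (φ.substC c z)

/-- Replacing the term `t₂` by the term `t₁`. -/
def Term.repl {Cons : Type} [DecidableEq Cons] (t₁ t₂ t : Term Cons) : Term Cons :=
  if t = t₂ then t₁ else t

/-- `φ.replace t₁ t₂` is `φ[t₁/t₂]`: the result of replacing `t₂` in `φ` with `t₁`. -/
def Form.replace {Pred Cons : Type} [DecidableEq Cons] (t₁ t₂ : Term Cons) :
    Form Pred Cons → Form Pred Cons
  | .pred P args => .pred P (args.map (Term.repl t₁ t₂))
  | .rel s₁ s₂ => .rel (Term.repl t₁ t₂ s₁) (Term.repl t₁ t₂ s₂)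
  | .eq s₁ s₂ => .eq (Term.repl t₁ t₂ s₁) (Term.repl t₁ t₂ s₂)
  | .neg φ => .neg (φ.replace t₁ t₂)
  | .and φ ψ => .and (φ.replace t₁ t₂) (ψ.replace t₁ t₂)
  | .Kt w t => .Kt w (Term.repl t₁ t₂ t)
  | .K w φ => .K w (φ.replace t₁ t₂)
  | .box w φ => .box w (φ.replace t₁ t₂)

/-- The list of all terms (constants and variables), for finite `Cons`. -/
noncomputable def allTerms (Cons : Type) [Fintype Cons] : List (Term Cons) :=
  (Finset.univ : Finset Cons).toList.map Term.const ++ [Term.var .x, Term.var .y]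

/-- The syntactic distance formulas `D^n t₁ t₂`. -/
noncomputable def distForm (Pred : Type) {Cons : Type} [Fintype Cons] :
    ℕ → Term Cons → Term Cons → Form Pred Cons
  | 0, t₁, t₂ => .eq t₁ t₂
  | n + 1, t₁, t₂ =>
      Form.or (distForm Pred n t₁ t₂)
        (Form.bigOr ((allTerms Cons).map fun t =>
          Form.and (distForm Pred n t₁ t) (Form.or (.rel t t₂) (.rel t₂ t))))

/-- `K_z z' = T`: the set `T` consists of the possible positions of `z'` considered by `z`. -/
noncomputable def KzEqSet {Pred Cons : Type} [Fintype Cons] [DecidableEq Cons]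
    (z z' : Var) (T : Finset Cons) : Form Pred Cons :=
  Form.bigAnd
    ((T.toList.map fun c => Form.diaK z (.eq (.var z') (.const c))) ++
      (Tᶜ.toList.map fun c => Form.K z (.neg (.eq (.var z') (.const c)))))

/-- `Rz = T`: `T` is exactly the set of (names of) R-successors of `z`. -/
noncomputable def RzEqSet {Pred Cons : Type} [Fintype Cons] [DecidableEq Cons]
    (z : Var) (T : Finset Cons) : Form Pred Cons :=
  Form.bigAnd
    ((T.toList.map fun c => Form.rel (.var z) (.const c)) ++
      (Tᶜ.toList.map fun c => Form.neg (Form.rel (.var z) (.const c))))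

/-- The list of all subsets of `Cons`. -/
noncomputable def powList (Cons : Type) [Fintype Cons] [DecidableEq Cons] : List (Finset Cons) :=
  (Finset.univ : Finset Cons).powerset.toList

/-! ### Semantics -/

/-- An interpretation of the vocabulary over a domain `D`. -/
structure Interp (Pred Cons D : Type) where
  pred : Pred → List D → Prop
  rel : D → D → Prop
  const : Cons → D

/-- Assignments (situations): positions of the two players. -/
abbrev Assign (D : Type) := Var → D

/-- The value of a term at an interpretation and a situation. -/
def Term.val {Pred Cons D : Type} (I : Interp Pred Cons D) (σ : Assign D) :
    Term Cons → D
  | .const c => I.const c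
  | .var v => σ v

/-- `Dball I m s` is `D^m(s)`: points reachable from `s` in at most `m` steps
along `I.rel` or its converse. -/
def Dball {Pred Cons D : Type} (I : Interp Pred Cons D) : ℕ → D → Set D
  | 0, s => {s}
  | m + 1, s => Dball I m s ∪ {t | ∃ u ∈ Dball I m s, I.rel u t ∨ I.rel t u}

/-- `R^z σ σ'`: player `z` moves along an arrow, the other player stays put. -/
def Rstep {Pred Cons D : Type} (I : Interp Pred Cons D) (z : Var) (σ σ' : Assign D) : Prop :=
  I.rel (σ z) (σ' z) ∧ σ z.other = σ' z.other

/-- Indistinguishability data: a relation on assignments for each player. -/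
abbrev SimRel (D : Type) := Var → Assign D → Assign D → Prop

/-- `Σ|σ`: the situations related to `σ` by some player's indistinguishability. -/
def restrict {D : Type} (Sit : Set (Assign D)) (sim : SimRel D) (σ : Assign D) :
    Set (Assign D) :=
  {σ' ∈ Sit | ∃ z, sim z σ σ'}

/-- The updated set of situations after player `z` moves from `σ₁` to `σ₂`. -/
def updSit {Pred Cons D : Type} (k : ℕ) (I : Interp Pred Cons D)
    (Sit : Set (Assign D)) (sim : SimRel D) (z : Var) (σ₁ σ₂ : Assign D) :
    Set (Assign D) :=
  {σ' | (σ₂ Var.x ∈ Dball I k (σ₂ Var.y) ∧ σ' = σ₂) ∨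
        (σ₂ Var.x ∉ Dball I k (σ₂ Var.y) ∧
          (∃ σ ∈ restrict Sit sim σ₁, Rstep I z σ σ') ∧
          σ' Var.x ∉ Dball I k (σ' Var.y))}

/-- The updated indistinguishability relations: `σ₁ ∼'_z σ₂` iff `σ₁ z = σ₂ z`. -/
def updSim (D : Type) : SimRel D := fun z σ₁ σ₂ => σ₁ z = σ₂ z

/-- Satisfaction for `ELCR` (with sight `k`). -/
def Sat {Pred Cons D : Type} (k : ℕ) (I : Interp Pred Cons D) :
    Set (Assign D) → SimRel D → Assign D → Form Pred Cons → Prop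
  | _, _, σ, .pred P args => I.pred P (args.map (Term.val I σ))
  | _, _, σ, .rel t₁ t₂ => I.rel (t₁.val I σ) (t₂.val I σ)
  | _, _, σ, .eq t₁ t₂ => t₁.val I σ = t₂.val I σ
  | Sit, sim, σ, .neg φ => ¬ Sat k I Sit sim σ φ
  | Sit, sim, σ, .and φ ψ => Sat k I Sit sim σ φ ∧ Sat k I Sit sim σ ψ
  | Sit, sim, σ, .Kt z t => ∀ σ' ∈ Sit, sim z σ' σ → t.val I σ = t.val I σ'
  | Sit, sim, σ, .K z φ => ∀ σ' ∈ Sit, sim z σ' σ → Sat k I Sit sim σ' φ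
  | Sit, sim, σ, .box z φ => ∀ σ₂, Rstep I z σ σ₂ →
      Sat k I (updSit k I Sit sim z σ σ₂) (updSim D) σ₂ φ

/-- The conditions making `(D, I, Σ, ∼)` a model: seriality of `I.rel`, every
point named by a constant, `Σ` nonempty, and each `∼_z` an equivalence relation on `Σ`. -/
structure IsModel {Pred Cons D : Type} (I : Interp Pred Cons D)
    (Sit : Set (Assign D)) (sim : SimRel D) : Prop where
  serial : ∀ s, ∃ t, I.rel s t
  const_surj : Function.Surjective I.const
  nonempty : Sit.Nonempty
  sim_mem : ∀ z σ σ', sim z σ σ' → σ ∈ Sit ∧ σ' ∈ Sit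
  sim_refl : ∀ z, ∀ σ ∈ Sit, sim z σ σ
  sim_symm : ∀ z σ σ', sim z σ σ' → sim z σ' σ
  sim_trans : ∀ z σ₁ σ₂ σ₃, sim z σ₁ σ₂ → sim z σ₂ σ₃ → sim z σ₁ σ₃

/-- The `k`-sight condition. -/
def KSight {Pred Cons D : Type} (k : ℕ) (I : Interp Pred Cons D)
    (Sit : Set (Assign D)) (sim : SimRel D) : Prop :=
  ∀ z σ σ', σ ∈ Sit → σ' ∈ Sit → sim z σ σ' →
    ∀ z', σ z' ∈ Dball I k (σ z) → σ z' = σ' z'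

/-- A nonempty conjunction `K_zα₁ ∧ ⋯ ∧ K_zαₙ ∧ ⟨K_z⟩β₁ ∧ ⋯ ∧ ⟨K_z⟩βₘ`. -/
def kConj {Pred Cons : Type} (z : Var) (αs βs : List (Form Pred Cons)) :
    Form Pred Cons :=
  Form.bigAnd (αs.map (Form.K z) ++ βs.map (Form.diaK z))
/-! ### The proof system ELCR⁻ -/

/-- Evaluation of a formula under a propositional valuation of its non-Boolean
components: used to define propositional tautologies. -/
def Form.evalProp {Pred Cons : Type} (v : Form Pred Cons → Prop) :
    Form Pred Cons → Prop
  | .neg φ => ¬ Form.evalProp v φ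
  | .and φ ψ => Form.evalProp v φ ∧ Form.evalProp v ψ
  | φ => v φ

/-- Propositional tautologies. -/
def Form.Tautology {Pred Cons : Type} (φ : Form Pred Cons) : Prop :=
  ∀ v : Form Pred Cons → Prop, Form.evalProp v φ

/-- The Hilbert-style proof system `ELCR⁻` for the static fragment, with sight `k`. -/
inductive Prov {Pred Cons : Type} [Fintype Cons] [DecidableEq Cons] (k : ℕ) :
    Form Pred Cons → Prop
  | taut {φ : Form Pred Cons} : φ.isStatic → φ.Tautology → Prov k φ
  | mp {φ ψ : Form Pred Cons} : Prov k (φ.imp ψ) → Prov k φ → Prov k ψ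
  | eqRefl (t : Term Cons) : Prov k (.eq t t)
  | eqSymm (t₁ t₂ : Term Cons) : Prov k ((Form.eq t₁ t₂).imp (.eq t₂ t₁))
  | eqTrans (t₁ t₂ t₃ : Term Cons) :
      Prov k (((Form.eq t₁ t₂).and (.eq t₂ t₃)).imp (.eq t₁ t₃))
  | eqSubst {α : Form Pred Cons} (t₁ t₂ : Term Cons) : α.isBase →
      Prov k ((Form.eq t₁ t₂).imp (α.iffF (α.replace t₁ t₂)))
  | seriality (c : Cons) :
      Prov k (Form.bigOr ((Finset.univ : Finset Cons).toList.map fun t =>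
        Form.rel (.const c) (.const t)))
  | atSomewhere (z : Var) :
      Prov k (Form.bigOr ((Finset.univ : Finset Cons).toList.map fun c =>
        Form.eq (.var z) (.const c)))
  | ksight (z : Var) (t : Term Cons) :
      Prov k ((distForm Pred k (.var z) t).imp (.Kt z t))
  | kAx {α β : Form Pred Cons} (z : Var) : α.isBase → β.isBase →
      Prov k ((Form.K z (α.imp β)).imp ((Form.K z α).imp (.K z β)))
  | tAx {α : Form Pred Cons} (z : Var) : α.isBase →
      Prov k ((Form.K z α).imp α)
  | kGround {α : Form Pred Cons} (z : Var) (T : Finset Cons) : α.isBase →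
      Prov k ((KzEqSet z z.other T).imp
        ((Form.K z α).iffF (Form.bigAnd (T.toList.map fun c => α.substC c z.other))))
  | kAdd {α : Form Pred Cons} (z : Var) (αs βs : List (Form Pred Cons)) :
      α.isBase → (∀ γ ∈ αs, γ.isBase) → (∀ γ ∈ βs, γ.isBase) →
      1 ≤ αs.length + βs.length →
      Prov k ((kConj z αs βs).imp α) → Prov k ((kConj z αs βs).imp (.K z α))
  | kElim {α β : Form Pred Cons} (z : Var) (αs βs : List (Form Pred Cons)) :
      α.isBase → β.isBase → (∀ γ ∈ αs, γ.isBase) → (∀ γ ∈ βs, γ.isBase) →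
      1 ≤ αs.length + βs.length →
      Prov k ((kConj z.other αs βs).imp ((Form.K z α).imp β)) →
      Prov k ((kConj z.other αs βs).imp (α.imp β))
  | deRe (z : Var) (t : Term Cons) (c : Cons) :
      Prov k ((Form.eq t (.const c)).imp
        ((Form.Kt z t).iffF (.K z (.eq t (.const c)))))
  | structK {α : Form Pred Cons} (z : Var) (T : Finset (Term Cons)) : α.isBase →
      (∀ t ∈ α.termList, t ∈ T) →
      Prov k (((Form.bigAnd (T.toList.map (Form.Kt z))).and α).imp (.K z α))

/-- A set of formulas is consistent if no finite conjunction from it proves `⊥`. -/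
def consistentS {Pred Cons : Type} [Fintype Cons] [DecidableEq Cons] (k : ℕ)
    (Γ : Set (Form Pred Cons)) : Prop :=
  ¬ ∃ l : List (Form Pred Cons), (∀ φ ∈ l, φ ∈ Γ) ∧
      Prov k ((Form.bigAnd l).imp Form.falseF)

/-- Maximally consistent sets of `L⁻`-formulas. -/
def MCS {Pred Cons : Type} [Fintype Cons] [DecidableEq Cons] (k : ℕ)
    (Δ : Set (Form Pred Cons)) : Prop :=
  consistentS k Δ ∧ (∀ φ ∈ Δ, Form.isStatic φ) ∧
    ∀ φ : Form Pred Cons, φ.isStatic → φ ∈ Δ ∨ Form.neg φ ∈ Δ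

/-- All terms of the formula are constants. -/
def isConsOnly {Pred Cons : Type} (φ : Form Pred Cons) : Prop :=
  ∀ t ∈ φ.termList, ∃ c : Cons, t = Term.const c

/-- `Δ₁ =^Cons Δ₂`: the two sets contain the same `L_B`-formulas whose terms are
all constants. -/
def consEq {Pred Cons : Type} (Δ₁ Δ₂ : Set (Form Pred Cons)) : Prop :=
  ∀ α : Form Pred Cons, α.isBase → isConsOnly α → (α ∈ Δ₁ ↔ α ∈ Δ₂)
/-! ### The canonical model -/

/-- The equivalence class of the constant `c` determined by `Δ₀`. -/
def eqClass {Pred Cons : Type} (Δ₀ : Set (Form Pred Cons)) (c : Cons) : Set Cons :=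
  {c' | Form.eq (Term.const c') (Term.const c) ∈ Δ₀}

/-- The canonical domain: equivalence classes of constants. -/
def CanD {Pred Cons : Type} (Δ₀ : Set (Form Pred Cons)) : Type :=
  {S : Set Cons // ∃ c, S = eqClass Δ₀ c}

/-- `[c]`, as an element of the canonical domain. -/
def canConst {Pred Cons : Type} (Δ₀ : Set (Form Pred Cons)) (c : Cons) : CanD Δ₀ :=
  ⟨eqClass Δ₀ c, c, rfl⟩

/-- The canonical interpretation. -/
def canI {Pred Cons : Type} (Δ₀ : Set (Form Pred Cons)) : Interp Pred Cons (CanD Δ₀) where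
  pred P ds := ∃ cs : List Cons, ds = cs.map (canConst Δ₀) ∧
    Form.pred P (cs.map Term.const) ∈ Δ₀
  rel d₁ d₂ := ∃ c₁ c₂, d₁ = canConst Δ₀ c₁ ∧ d₂ = canConst Δ₀ c₂ ∧
    Form.rel (Term.const c₁) (Term.const c₂) ∈ Δ₀
  const := canConst Δ₀

/-- `K_z Δ := {α : K_z α ∈ Δ}`. -/
def Kset {Pred Cons : Type} (z : Var) (Δ : Set (Form Pred Cons)) : Set (Form Pred Cons) :=
  {α | Form.K z α ∈ Δ}

/-- The canonical set of situations, as a collection of MCSs. -/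
def CanSit {Pred Cons : Type} [Fintype Cons] [DecidableEq Cons] (k : ℕ)
    (Δ₀ : Set (Form Pred Cons)) (Ty Tx : Finset Cons) (cx cy : Cons) :
    Set (Set (Form Pred Cons)) :=
  {Δ₀} ∪
  {Δ | MCS k Δ ∧ consEq Δ Δ₀ ∧ KzEqSet Var.x Var.y Ty ∈ Δ ∧
      Form.K Var.y (Form.eq (.var .x) (.const cx)) ∈ Δ ∧
      ∃ c ∈ Ty, Form.eq (.var .y) (.const c) ∈ Δ ∧
        Form.neg (Form.eq (.const c) (.const cy)) ∈ Δ} ∪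
  {Δ | MCS k Δ ∧ consEq Δ Δ₀ ∧ KzEqSet Var.y Var.x Tx ∈ Δ ∧
      Form.K Var.x (Form.eq (.var .y) (.const cy)) ∈ Δ ∧
      ∃ c ∈ Tx, Form.eq (.var .x) (.const c) ∈ Δ ∧
        Form.neg (Form.eq (.const c) (.const cx)) ∈ Δ}

/-- The assignment induced by an MCS `Δ`: `Δ(z) = [c]` whenever `z ≡ c ∈ Δ`. -/
noncomputable def canAsg {Pred Cons : Type} [Nonempty Cons]
    (Δ₀ Δ : Set (Form Pred Cons)) : Assign (CanD Δ₀) := fun z =>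
  canConst Δ₀ (open Classical in
    if h : ∃ c : Cons, Form.eq (Term.var z) (Term.const c) ∈ Δ then h.choose
    else Classical.arbitrary Cons)

/-- The canonical set of situations, as a set of assignments. -/
noncomputable def CanSitA {Pred Cons : Type} [Fintype Cons] [DecidableEq Cons] [Nonempty Cons]
    (k : ℕ) (Δ₀ : Set (Form Pred Cons)) (Ty Tx : Finset Cons) (cx cy : Cons) :
    Set (Assign (CanD Δ₀)) :=
  canAsg Δ₀ '' CanSit k Δ₀ Ty Tx cx cy

/-- The canonical indistinguishability relations: `Δ₁ ∼_z Δ₂` iff `K_z Δ₁ = K_z Δ₂`. -/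
def canSim {Pred Cons : Type} [Nonempty Cons] (Δ₀ : Set (Form Pred Cons))
    (S : Set (Set (Form Pred Cons))) : SimRel (CanD Δ₀) := fun z σ₁ σ₂ =>
  ∃ Δ₁ ∈ S, ∃ Δ₂ ∈ S, σ₁ = canAsg Δ₀ Δ₁ ∧ σ₂ = canAsg Δ₀ Δ₂ ∧ Kset z Δ₁ = Kset z Δ₂

namespace Form

variable {Pred Cons : Type}

lemma isBase.isStatic {φ : Form Pred Cons} (h : φ.isBase) : φ.isStatic := by
  induction φ with
  | neg φ ih => exact ih h
  | and φ ψ ih₁ ih₂ => exact ⟨ih₁ h.1, ih₂ h.2⟩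
  | _ => simp_all [Form.isBase, Form.isStatic]

lemma isStatic_bigAnd {l : List (Form Pred Cons)} (h : ∀ φ ∈ l, φ.isStatic) :
    (bigAnd l).isStatic := by
  induction l with
  | nil => simp [bigAnd, trueF, falseF, isStatic]
  | cons φ l ih =>
    exact ⟨h φ (by simp), ih fun ψ hψ => h ψ (by simp [hψ])⟩

lemma isStatic_bigOr {l : List (Form Pred Cons)} (h : ∀ φ ∈ l, φ.isStatic) :
    (bigOr l).isStatic := by
  induction l with
  | nil => simp [bigOr, falseF, isStatic]
  | cons φ l ih =>
    exact ⟨h φ (by simp), ih fun ψ hψ => h ψ (by simp [hψ])⟩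

lemma isStatic_distForm [Fintype Cons] (n : ℕ) (t₁ t₂ : Term Cons) :
    (distForm Pred n t₁ t₂).isStatic := by
  induction n generalizing t₂ with
  | zero => simp [distForm, isStatic]
  | succ n ih =>
    refine ⟨ih t₂, isStatic_bigOr fun φ hφ => ?_⟩
    obtain ⟨t, -, rfl⟩ := List.mem_map.1 hφ
    exact ⟨ih t, trivial, trivial⟩

lemma isStatic_KzEqSet [Fintype Cons] [DecidableEq Cons] (z z' : Var) (T : Finset Cons) :
    (KzEqSet z z' T : Form Pred Cons).isStatic := by
  refine isStatic_bigAnd fun φ hφ => ?_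
  simp only [List.mem_append, List.mem_map] at hφ
  rcases hφ with ⟨c, -, rfl⟩ | ⟨c, -, rfl⟩ <;> simp [diaK, isStatic, isBase]

lemma isBase.substC {φ : Form Pred Cons} (h : φ.isBase) (c : Cons) (z : Var) :
    (φ.substC c z).isBase := by
  induction φ with
  | neg φ ih => exact ih h
  | and φ ψ ih₁ ih₂ => exact ⟨ih₁ h.1, ih₂ h.2⟩
  | _ => simp_all [Form.isBase, Form.substC]

/-- Applying a function to all terms occurring in a formula (outside the indices of modalities). -/
def mapTerm (s : Term Cons → Term Cons) : Form Pred Cons → Form Pred Cons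
  | .pred P args => .pred P (args.map s)
  | .rel t₁ t₂ => .rel (s t₁) (s t₂)
  | .eq t₁ t₂ => .eq (s t₁) (s t₂)
  | .neg φ => .neg (φ.mapTerm s)
  | .and φ ψ => .and (φ.mapTerm s) (ψ.mapTerm s)
  | .Kt w t => .Kt w (s t)
  | .K w φ => .K w (φ.mapTerm s)
  | .box w φ => .box w (φ.mapTerm s)

lemma mapTerm_id (φ : Form Pred Cons) : φ.mapTerm (fun t => t) = φ := by
  induction φ <;> simp_all [mapTerm]

lemma isBase.mapTerm {φ : Form Pred Cons} (h : φ.isBase) (s : Term Cons → Term Cons) :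
    (φ.mapTerm s).isBase := by
  induction φ with
  | neg φ ih => exact ih h
  | and φ ψ ih₁ ih₂ => exact ⟨ih₁ h.1, ih₂ h.2⟩
  | _ => simp_all [Form.isBase, Form.mapTerm]

lemma replace_mapTerm [DecidableEq Cons] (t₁ t₂ : Term Cons) (s : Term Cons → Term Cons)
    (φ : Form Pred Cons) :
    (φ.mapTerm s).replace t₁ t₂ = φ.mapTerm (fun t => Term.repl t₁ t₂ (s t)) := by
  induction φ <;> simp_all [mapTerm, replace]

lemma termList_mapTerm (s : Term Cons → Term Cons) (φ : Form Pred Cons) :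
    (φ.mapTerm s).termList = φ.termList.map s := by
  induction φ <;> simp_all [mapTerm, termList]

end Form

lemma mem_allTerms {Cons : Type} [Fintype Cons] (t : Term Cons) : t ∈ allTerms Cons := by
  rcases t with c | v | v <;> simp [allTerms]

section

variable {Pred Cons : Type} {Δ₀ Δ : Set (Form Pred Cons)}

lemma consEq.eq_const_mem_iff (hE : consEq Δ Δ₀) {c d : Cons} :
    Form.eq (.const c) (.const d) ∈ Δ ↔ Form.eq (.const c) (.const d) ∈ Δ₀ :=
  hE _ trivial (by simp [isConsOnly, Form.termList])

/-- A constant naming the value of a term in the canonical model. -/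
noncomputable def canRep (Δ₀ : Set (Form Pred Cons)) (σ : Assign (CanD Δ₀)) (t : Term Cons) :
    Term Cons :=
  .const (t.val (canI Δ₀) σ).2.choose

lemma val_canRep (σ : Assign (CanD Δ₀)) (t : Term Cons) :
    (canRep Δ₀ σ t).val (canI Δ₀) σ = t.val (canI Δ₀) σ :=
  Subtype.ext (t.val (canI Δ₀) σ).2.choose_spec.symm

lemma canRep_congr {σ : Assign (CanD Δ₀)} {t t' : Term Cons}
    (h : t.val (canI Δ₀) σ = t'.val (canI Δ₀) σ) : canRep Δ₀ σ t = canRep Δ₀ σ t' := by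
  simp only [canRep, h]

end

section

variable {Pred Cons : Type} [Fintype Cons] [DecidableEq Cons] {k : ℕ}

namespace MCS

variable {Δ : Set (Form Pred Cons)}

lemma false_of_mem_of_neg_mem (h : MCS k Δ) {φ : Form Pred Cons} (h₁ : φ ∈ Δ)
    (h₂ : φ.neg ∈ Δ) : False := by
  refine h.1 ⟨[φ, φ.neg], by simp [h₁, h₂], .taut ?_ fun v => ?_⟩
  · simp [Form.bigAnd, Form.imp, Form.trueF, Form.falseF, Form.isStatic, h.2.1 φ h₁]
  · simp only [Form.bigAnd, Form.imp, Form.trueF, Form.falseF, Form.evalProp]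
    tauto

lemma neg_mem_iff (h : MCS k Δ) {φ : Form Pred Cons} (hφ : φ.isStatic) :
    φ.neg ∈ Δ ↔ φ ∉ Δ :=
  ⟨fun h₁ h₂ => h.false_of_mem_of_neg_mem h₂ h₁, fun h₁ => (h.2.2 φ hφ).resolve_left h₁⟩

lemma mem_of_prov (h : MCS k Δ) {φ : Form Pred Cons} (hφ : φ.isStatic) (hp : Prov k φ) :
    φ ∈ Δ := by
  by_contra hn
  refine h.1 ⟨[φ.neg], by simp [h.neg_mem_iff hφ, hn], .mp (.taut ?_ fun v => ?_) hp⟩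
  · simp [Form.bigAnd, Form.imp, Form.trueF, Form.falseF, Form.isStatic, hφ]
  · simp only [Form.bigAnd, Form.imp, Form.trueF, Form.falseF, Form.evalProp]
    tauto

lemma and_mem_iff (h : MCS k Δ) {φ ψ : Form Pred Cons} :
    φ.and ψ ∈ Δ ↔ φ ∈ Δ ∧ ψ ∈ Δ := by
  constructor
  · intro h₁
    have hs := h.2.1 _ h₁
    constructor
    · by_contra hn
      rw [← h.neg_mem_iff hs.1] at hn
      refine h.1 ⟨[φ.and ψ, φ.neg], by simp [h₁, hn], .taut ?_ fun v => ?_⟩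
      · simp [Form.bigAnd, Form.imp, Form.trueF, Form.falseF, Form.isStatic, hs.1, hs.2]
      · simp only [Form.bigAnd, Form.imp, Form.trueF, Form.falseF, Form.evalProp]
        tauto
    · by_contra hn
      rw [← h.neg_mem_iff hs.2] at hn
      refine h.1 ⟨[φ.and ψ, ψ.neg], by simp [h₁, hn], .taut ?_ fun v => ?_⟩
      · simp [Form.bigAnd, Form.imp, Form.trueF, Form.falseF, Form.isStatic, hs.1, hs.2]
      · simp only [Form.bigAnd, Form.imp, Form.trueF, Form.falseF, Form.evalProp]
        tauto
  · rintro ⟨h₁, h₂⟩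
    have s₁ := h.2.1 _ h₁
    have s₂ := h.2.1 _ h₂
    by_contra hn
    rw [← h.neg_mem_iff (φ := φ.and ψ) ⟨s₁, s₂⟩] at hn
    refine h.1 ⟨[φ, ψ, (φ.and ψ).neg], by simp [h₁, h₂, hn], .taut ?_ fun v => ?_⟩
    · simp [Form.bigAnd, Form.imp, Form.trueF, Form.falseF, Form.isStatic, s₁, s₂]
    · simp only [Form.bigAnd, Form.imp, Form.trueF, Form.falseF, Form.evalProp]
      tauto

lemma imp_mem_iff (h : MCS k Δ) {φ ψ : Form Pred Cons} (hφ : φ.isStatic) (hψ : ψ.isStatic) :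
    φ.imp ψ ∈ Δ ↔ (φ ∈ Δ → ψ ∈ Δ) := by
  rw [Form.imp, h.neg_mem_iff (φ := φ.and ψ.neg) ⟨hφ, hψ⟩, h.and_mem_iff, h.neg_mem_iff hψ]
  tauto

lemma or_mem_iff (h : MCS k Δ) {φ ψ : Form Pred Cons} (hφ : φ.isStatic) (hψ : ψ.isStatic) :
    φ.or ψ ∈ Δ ↔ φ ∈ Δ ∨ ψ ∈ Δ := by
  rw [Form.or, h.neg_mem_iff (φ := φ.neg.and ψ.neg) ⟨hφ, hψ⟩, h.and_mem_iff, h.neg_mem_iff hφ,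
    h.neg_mem_iff hψ]
  tauto

lemma iffF_mem_iff (h : MCS k Δ) {φ ψ : Form Pred Cons} (hφ : φ.isStatic) (hψ : ψ.isStatic) :
    φ.iffF ψ ∈ Δ ↔ (φ ∈ Δ ↔ ψ ∈ Δ) := by
  rw [Form.iffF, h.and_mem_iff, h.imp_mem_iff hφ hψ, h.imp_mem_iff hψ hφ]
  tauto

lemma mem_of_prov_imp (h : MCS k Δ) {φ ψ : Form Pred Cons} (hψ : ψ.isStatic)
    (hp : Prov k (φ.imp ψ)) (hφ : φ ∈ Δ) : ψ ∈ Δ :=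
  (h.imp_mem_iff (h.2.1 _ hφ) hψ).1 (h.mem_of_prov ⟨h.2.1 _ hφ, hψ⟩ hp) hφ

lemma eq_refl_mem (h : MCS k Δ) (t : Term Cons) : Form.eq t t ∈ Δ :=
  h.mem_of_prov trivial (.eqRefl t)

lemma eq_symm_mem (h : MCS k Δ) {t₁ t₂ : Term Cons} (h₁ : Form.eq t₁ t₂ ∈ Δ) :
    Form.eq t₂ t₁ ∈ Δ :=
  h.mem_of_prov_imp trivial (.eqSymm t₁ t₂) h₁

lemma eq_trans_mem (h : MCS k Δ) {t₁ t₂ t₃ : Term Cons} (h₁ : Form.eq t₁ t₂ ∈ Δ)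
    (h₂ : Form.eq t₂ t₃ ∈ Δ) : Form.eq t₁ t₃ ∈ Δ :=
  h.mem_of_prov_imp trivial (.eqTrans t₁ t₂ t₃) (h.and_mem_iff.2 ⟨h₁, h₂⟩)

lemma falseF_notMem (h : MCS k Δ) : Form.falseF ∉ Δ := fun h₁ =>
  h.false_of_mem_of_neg_mem (h.eq_refl_mem (.var .x)) h₁

lemma trueF_mem (h : MCS k Δ) : Form.trueF ∈ Δ :=
  (h.neg_mem_iff (φ := Form.falseF) trivial).2 h.falseF_notMem

lemma bigAnd_mem_iff (h : MCS k Δ) {l : List (Form Pred Cons)} :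
    Form.bigAnd l ∈ Δ ↔ ∀ φ ∈ l, φ ∈ Δ := by
  induction l with
  | nil =>
    simpa [Form.bigAnd] using h.trueF_mem
  | cons φ l ih => simp [Form.bigAnd, h.and_mem_iff, ih]

lemma bigOr_mem_iff (h : MCS k Δ) {l : List (Form Pred Cons)} (hl : ∀ φ ∈ l, φ.isStatic) :
    Form.bigOr l ∈ Δ ↔ ∃ φ ∈ l, φ ∈ Δ := by
  induction l with
  | nil => simpa [Form.bigOr] using h.falseF_notMem
  | cons φ l ih =>
    have hl' : ∀ ψ ∈ l, ψ.isStatic := fun ψ hψ => hl ψ (by simp [hψ])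
    rw [Form.bigOr, h.or_mem_iff (hl φ (by simp)) (Form.isStatic_bigOr hl'), ih hl']
    simp

lemma exists_var_eq_mem (h : MCS k Δ) (z : Var) :
    ∃ c : Cons, Form.eq (.var z) (.const c) ∈ Δ := by
  have hs : ∀ φ ∈ (Finset.univ : Finset Cons).toList.map fun c =>
      (Form.eq (.var z) (.const c) : Form Pred Cons), φ.isStatic := by
    simp [Form.isStatic]
  simpa using (h.bigOr_mem_iff hs).1 (h.mem_of_prov (Form.isStatic_bigOr hs) (.atSomewhere z))

lemma exists_rel_mem (h : MCS k Δ) (c : Cons) :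
    ∃ c' : Cons, Form.rel (.const c) (.const c') ∈ Δ := by
  have hs : ∀ φ ∈ (Finset.univ : Finset Cons).toList.map fun t =>
      (Form.rel (.const c) (.const t) : Form Pred Cons), φ.isStatic := by
    simp [Form.isStatic]
  simpa using (h.bigOr_mem_iff hs).1 (h.mem_of_prov (Form.isStatic_bigOr hs) (.seriality c))

lemma mem_of_K_mem (h : MCS k Δ) {z : Var} {α : Form Pred Cons} (h₁ : Form.K z α ∈ Δ) :
    α ∈ Δ :=
  have hα : α.isBase := h.2.1 _ h₁
  h.mem_of_prov_imp hα.isStatic (.tAx z hα) h₁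

lemma K_mem_of_imp (h : MCS k Δ) {z : Var} {α β : Form Pred Cons} (hα : α.isBase)
    (hβ : β.isBase) (h₁ : Form.K z (α.imp β) ∈ Δ) (h₂ : Form.K z α ∈ Δ) : Form.K z β ∈ Δ :=
  (h.imp_mem_iff (φ := Form.K z α) (ψ := Form.K z β) hα hβ).1
    (h.mem_of_prov_imp (ψ := (Form.K z α).imp (Form.K z β)) ⟨hα, hβ⟩ (.kAx z hα hβ) h₁) h₂

/-- Necessitation holds in any MCS that contains at least one knowledge formula. -/
lemma K_mem_of_prov (h : MCS k Δ) {z : Var} {α γ : Form Pred Cons} (hα : α.isBase)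
    (hγ : Form.K z γ ∈ Δ) (hp : Prov k α) : Form.K z α ∈ Δ := by
  have hγb : γ.isBase := h.2.1 _ hγ
  refine h.mem_of_prov_imp (φ := kConj z [γ] []) hα
    (.kAdd z [γ] [] hα (by simpa using hγb) (by simp) (by simp) (.mp (.taut ?_ fun v => ?_) hp))
    (h.bigAnd_mem_iff.2 (by simpa using hγ))
  · simp [kConj, Form.bigAnd, Form.imp, Form.trueF, Form.falseF, Form.isStatic, hγb, hα.isStatic]
  · simp only [Form.imp, Form.evalProp]
    tauto

lemma K_neg_const_eq_mem (h : MCS k Δ) {z : Var} {γ : Form Pred Cons} (hγ : Form.K z γ ∈ Δ)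
    {c d : Cons} (hcd : Form.neg (.eq (.const d) (.const c)) ∈ Δ) :
    Form.K z (.neg (.eq (.const d) (.const c))) ∈ Δ := by
  have hKt (e : Cons) : Form.Kt z (.const e) ∈ Δ := by
    refine ((h.iffF_mem_iff (φ := Form.Kt z (.const e)) (ψ := Form.K z (.eq (.const e) (.const e)))
      trivial trivial).1 (h.mem_of_prov_imp ?_ (.deRe z (.const e) e) (h.eq_refl_mem _))).2
      (h.K_mem_of_prov trivial hγ (.eqRefl _))
    exact ⟨⟨trivial, trivial⟩, ⟨trivial, trivial⟩⟩
  refine h.mem_of_prov_imp trivial (.structK z {.const d, .const c} trivial ?_)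
    (h.and_mem_iff.2 ⟨h.bigAnd_mem_iff.2 fun φ hφ => ?_, hcd⟩)
  · simp [Form.termList]
  · obtain ⟨t, ht, rfl⟩ := List.mem_map.1 hφ
    simp only [Finset.mem_toList, Finset.mem_insert, Finset.mem_singleton] at ht
    rcases ht with rfl | rfl <;> exact hKt _

lemma KzEqSet_mem (h : MCS k Δ) {z z' : Var} {c : Cons} {T : Finset Cons}
    (hK : Form.K z (.eq (.var z') (.const c)) ∈ Δ)
    (hT : ∀ d, d ∈ T ↔ Form.eq (.const d) (.const c) ∈ Δ) : KzEqSet z z' T ∈ Δ := by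
  have hz' := h.mem_of_K_mem hK
  refine h.bigAnd_mem_iff.2 fun φ hφ => ?_
  simp only [List.mem_append, List.mem_map, Finset.mem_toList, Finset.mem_compl, hT] at hφ
  rcases hφ with ⟨d, hd, rfl⟩ | ⟨d, hd, rfl⟩
  · rw [Form.diaK, h.neg_mem_iff (by trivial)]
    exact fun hn => h.false_of_mem_of_neg_mem (h.eq_trans_mem hz' (h.eq_symm_mem hd))
      (h.mem_of_K_mem hn)
  · have hdc := h.K_neg_const_eq_mem hK ((h.neg_mem_iff
      (φ := .eq (.const d) (.const c)) trivial).2 hd)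
    have hp : Prov k (Form.imp (.neg (.eq (.const d) (.const c)))
        (Form.imp (.eq (.var z') (.const c)) (.neg (.eq (.var z') (.const d)))) :
        Form Pred Cons) := by
      refine .mp (.mp (.taut ?_ fun v => ?_) (.eqSymm (.var z') (.const d)))
        (.eqTrans (.const d) (.var z') (.const c))
      · simp [Form.imp, Form.isStatic]
      · simp only [Form.imp, Form.evalProp]
        tauto
    have hp' := h.K_mem_of_prov (z := z) (by simp [Form.imp, Form.isBase]) hK hp
    refine h.K_mem_of_imp ?_ ?_ (h.K_mem_of_imp ?_ ?_ hp' hdc) hK <;>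
      simp [Form.imp, Form.isBase]

lemma K_mem_iff (h : MCS k Δ) {z : Var} {T : Finset Cons} (hT : KzEqSet z z.other T ∈ Δ)
    {α : Form Pred Cons} (hα : α.isBase) :
    Form.K z α ∈ Δ ↔ ∀ c ∈ T, α.substC c z.other ∈ Δ := by
  have hs : (Form.bigAnd (T.toList.map fun c => α.substC c z.other)).isStatic :=
    Form.isStatic_bigAnd fun φ hφ => by
      obtain ⟨c, -, rfl⟩ := List.mem_map.1 hφ
      exact (hα.substC c _).isStatic
  rw [(h.iffF_mem_iff (φ := Form.K z α) hα hs).1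
    (h.mem_of_prov_imp ⟨⟨hα, hs⟩, ⟨hs, hα⟩⟩ (.kGround z T hα) hT), h.bigAnd_mem_iff]
  simp

/-- Replacing every term by a provably equal normal form does not affect membership. -/
lemma mapTerm_mem_iff (h : MCS k Δ) {r : Term Cons → Term Cons} (hr : ∀ t, r (r t) = r t)
    (hΔ : ∀ t, Form.eq (r t) t ∈ Δ) {α : Form Pred Cons} (hα : α.isBase) :
    α ∈ Δ ↔ α.mapTerm r ∈ Δ := by
  have key (F : Finset (Term Cons)) :
      α ∈ Δ ↔ α.mapTerm (fun t => if t ∈ F then r t else t) ∈ Δ := by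
    induction F using Finset.induction_on with
    | empty => simp [Form.mapTerm_id]
    | insert a F _ ih =>
      have hb : (α.mapTerm (fun t => if t ∈ F then r t else t)).isBase := hα.mapTerm _
      have he : (fun t => Term.repl (r a) a (if t ∈ F then r t else t)) =
          fun t => if t ∈ insert a F then r t else t := by
        funext t
        by_cases ht : t ∈ F <;> by_cases hta : t = a <;> by_cases hra : r t = a <;>
          simp_all [Term.repl]
        all_goals (subst hra; simp [hr])
      have hb' := hα.mapTerm (fun t => if t ∈ insert a F then r t else t)
      have hp := Prov.eqSubst (k := k) (r a) a hb
      rw [Form.replace_mapTerm, he] at hp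
      rw [ih]
      exact (h.iffF_mem_iff hb.isStatic hb'.isStatic).1 (h.mem_of_prov_imp
        ⟨⟨hb.isStatic, hb'.isStatic⟩, ⟨hb'.isStatic, hb.isStatic⟩⟩ hp (hΔ a))
  simpa [mem_allTerms] using key (allTerms Cons).toFinset

end MCS

section Canonical

variable {Δ₀ Δ Δ' : Set (Form Pred Cons)}

lemma canConst_eq_iff (hM : MCS k Δ₀) {c d : Cons} :
    canConst Δ₀ c = canConst Δ₀ d ↔ Form.eq (.const c) (.const d) ∈ Δ₀ := by
  constructor
  · intro h
    have h' : eqClass Δ₀ c = eqClass Δ₀ d := congrArg Subtype.val h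
    have : c ∈ eqClass Δ₀ d := h' ▸ hM.eq_refl_mem _
    exact this
  · intro h
    refine Subtype.ext (Set.ext fun e => ?_)
    exact ⟨fun he => hM.eq_trans_mem he h, fun he => hM.eq_trans_mem he (hM.eq_symm_mem h)⟩

variable {Ty Tx : Finset Cons} {cx cy : Cons}

lemma CanSit.mcs_and_consEq (hM : MCS k Δ₀) (hΔ : Δ ∈ CanSit k Δ₀ Ty Tx cx cy) :
    MCS k Δ ∧ consEq Δ Δ₀ := by
  rcases hΔ with (rfl | hΔ) | hΔ
  · exact ⟨hM, fun _ _ _ => Iff.rfl⟩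
  · exact ⟨hΔ.1, hΔ.2.1⟩
  · exact ⟨hΔ.1, hΔ.2.1⟩

lemma exists_KzEqSet_mem (h : MCS k Δ) (hE : consEq Δ Δ₀) (h' : MCS k Δ') (hE' : consEq Δ' Δ₀)
    {z z' : Var} {c : Cons} (hK : Form.K z (.eq (.var z') (.const c)) ∈ Δ)
    (hK' : Form.K z (.eq (.var z') (.const c)) ∈ Δ') :
    ∃ T : Finset Cons, KzEqSet z z' T ∈ Δ ∧ KzEqSet z z' T ∈ Δ' := by
  classical
  exact ⟨Finset.univ.filter fun d => Form.eq (.const d) (.const c) ∈ Δ₀,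
    h.KzEqSet_mem hK (by simp [hE.eq_const_mem_iff]),
    h'.KzEqSet_mem hK' (by simp [hE'.eq_const_mem_iff])⟩

variable [Nonempty Cons]

lemma val_canAsg_eq_iff (hM : MCS k Δ₀) (h : MCS k Δ) (hE : consEq Δ Δ₀) {t : Term Cons}
    {c : Cons} :
    t.val (canI Δ₀) (canAsg Δ₀ Δ) = canConst Δ₀ c ↔ Form.eq t (.const c) ∈ Δ := by
  cases t with
  | const d =>
    exact (canConst_eq_iff hM).trans hE.eq_const_mem_iff.symm
  | var z =>
    have hz := h.exists_var_eq_mem z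
    have hc := hz.choose_spec
    rw [Term.val, canAsg, dif_pos hz, canConst_eq_iff hM, ← hE.eq_const_mem_iff]
    exact ⟨h.eq_trans_mem hc, h.eq_trans_mem (h.eq_symm_mem hc)⟩

lemma mem_iff_mapTerm_canRep_mem (hM : MCS k Δ₀) (h : MCS k Δ) (hE : consEq Δ Δ₀)
    {α : Form Pred Cons} (hα : α.isBase) :
    α ∈ Δ ↔ α.mapTerm (canRep Δ₀ (canAsg Δ₀ Δ)) ∈ Δ :=
  h.mapTerm_mem_iff (fun t => canRep_congr (val_canRep _ t))
    (fun t => h.eq_symm_mem ((val_canAsg_eq_iff hM h hE).1 (val_canRep _ t).symm)) hα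

lemma rel_val_iff (hM : MCS k Δ₀) (h : MCS k Δ) (hE : consEq Δ Δ₀) {t₁ t₂ : Term Cons} :
    (canI Δ₀).rel (t₁.val (canI Δ₀) (canAsg Δ₀ Δ)) (t₂.val (canI Δ₀) (canAsg Δ₀ Δ)) ↔
      Form.rel t₁ t₂ ∈ Δ := by
  have hc (c₁ c₂ : Cons) : (Form.rel (.const c₁) (.const c₂) ∈ Δ ↔
      Form.rel (.const c₁) (.const c₂) ∈ Δ₀) :=
    hE _ trivial (by simp [isConsOnly, Form.termList])
  have hrep (s₁ s₂ : Term Cons) : Form.rel s₁ s₂ ∈ Δ ↔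
      Form.rel (canRep Δ₀ (canAsg Δ₀ Δ) s₁) (canRep Δ₀ (canAsg Δ₀ Δ) s₂) ∈ Δ :=
    mem_iff_mapTerm_canRep_mem (α := .rel s₁ s₂) hM h hE trivial
  constructor
  · rintro ⟨c₁, c₂, h₁, h₂, hr⟩
    rw [← hc, hrep] at hr
    rw [hrep]
    rwa [canRep_congr (t' := .const c₁) h₁, canRep_congr (t' := .const c₂) h₂]
  · intro hr
    rw [hrep] at hr
    exact ⟨_, _, (val_canRep _ t₁).symm, (val_canRep _ t₂).symm, (hc _ _).1 hr⟩

lemma pred_canConst_iff (hM : MCS k Δ₀) (P : Pred) (cs : List Cons) :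
    (canI Δ₀).pred P (cs.map (canConst Δ₀)) ↔ Form.pred P (cs.map Term.const) ∈ Δ₀ := by
  refine ⟨?_, fun h => ⟨cs, rfl, h⟩⟩
  rintro ⟨ds, hd, h⟩
  have hE : consEq Δ₀ Δ₀ := fun _ _ _ => Iff.rfl
  have hrep (l : List Cons) : Form.pred P (l.map Term.const) ∈ Δ₀ ↔
      Form.pred P ((l.map (canConst Δ₀)).map fun d => Term.const d.2.choose) ∈ Δ₀ := by
    rw [mem_iff_mapTerm_canRep_mem (α := .pred P (l.map Term.const)) hM hM hE trivial,
      Form.mapTerm, List.map_map, List.map_map]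
    rfl
  rwa [hrep, hd, ← hrep]

lemma distForm_mem_of_val_mem_Dball (hM : MCS k Δ₀) (h : MCS k Δ) (hE : consEq Δ Δ₀) (n : ℕ)
    {t₁ t₂ : Term Cons}
    (hD : t₂.val (canI Δ₀) (canAsg Δ₀ Δ) ∈
      Dball (canI Δ₀) n (t₁.val (canI Δ₀) (canAsg Δ₀ Δ))) :
    distForm Pred n t₁ t₂ ∈ Δ := by
  induction n generalizing t₂ with
  | zero =>
    have hv : t₂.val (canI Δ₀) (canAsg Δ₀ Δ) = t₁.val (canI Δ₀) (canAsg Δ₀ Δ) := hD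
    have hr := val_canRep (canAsg Δ₀ Δ) t₁
    exact h.eq_trans_mem ((val_canAsg_eq_iff hM h hE).1 hr.symm)
      (h.eq_symm_mem ((val_canAsg_eq_iff hM h hE).1 (hv.trans hr.symm)))
  | succ n ih =>
    have hs : ∀ φ ∈ (allTerms Cons).map fun t =>
        Form.and (distForm Pred n t₁ t) (Form.or (.rel t t₂) (.rel t₂ t)), φ.isStatic := by
      intro φ hφ
      obtain ⟨t, -, rfl⟩ := List.mem_map.1 hφ
      exact ⟨Form.isStatic_distForm n t₁ t, trivial, trivial⟩
    rw [distForm, h.or_mem_iff (Form.isStatic_distForm n t₁ t₂) (Form.isStatic_bigOr hs),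
      h.bigOr_mem_iff hs]
    rcases hD with hD | ⟨u, hu, hr⟩
    · exact .inl (ih hD)
    · obtain ⟨c, hc⟩ := u.2
      obtain rfl : u = (Term.const c).val (canI Δ₀) (canAsg Δ₀ Δ) := Subtype.ext hc
      rw [rel_val_iff hM h hE, rel_val_iff hM h hE] at hr
      exact .inr ⟨_, List.mem_map_of_mem (mem_allTerms (.const c)),
        h.and_mem_iff.2 ⟨ih hu, (h.or_mem_iff (φ := .rel _ _) (ψ := .rel _ _) trivial trivial).2 hr⟩⟩

lemma mem_iff_mem_of_canAsg_eq (hM : MCS k Δ₀) (h : MCS k Δ) (hE : consEq Δ Δ₀)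
    (h' : MCS k Δ') (hE' : consEq Δ' Δ₀) (ha : canAsg Δ₀ Δ = canAsg Δ₀ Δ')
    {α : Form Pred Cons} (hα : α.isBase) : α ∈ Δ ↔ α ∈ Δ' := by
  have hc : isConsOnly (α.mapTerm (canRep Δ₀ (canAsg Δ₀ Δ'))) := by
    intro t ht
    rw [Form.termList_mapTerm] at ht
    obtain ⟨s, -, rfl⟩ := List.mem_map.1 ht
    exact ⟨_, rfl⟩
  rw [mem_iff_mapTerm_canRep_mem hM h hE hα, mem_iff_mapTerm_canRep_mem hM h' hE' hα, ha,
    hE _ (hα.mapTerm _) hc, hE' _ (hα.mapTerm _) hc]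

lemma Kset_eq_of_canAsg_eq (hM : MCS k Δ₀) (h : MCS k Δ) (hE : consEq Δ Δ₀)
    (h' : MCS k Δ') (hE' : consEq Δ' Δ₀) (ha : canAsg Δ₀ Δ = canAsg Δ₀ Δ') {z : Var}
    {T : Finset Cons} (hT : KzEqSet z z.other T ∈ Δ) (hT' : KzEqSet z z.other T ∈ Δ') :
    Kset z Δ = Kset z Δ' := by
  have key {α : Form Pred Cons} (hα : α.isBase) : Form.K z α ∈ Δ ↔ Form.K z α ∈ Δ' := by
    rw [h.K_mem_iff hT hα, h'.K_mem_iff hT' hα]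
    exact forall₂_congr fun c _ => mem_iff_mem_of_canAsg_eq hM h hE h' hE' ha (hα.substC c _)
  ext α
  exact ⟨fun hK => (key (h.2.1 _ hK)).1 hK, fun hK => (key (h'.2.1 _ hK)).2 hK⟩

lemma canAsg_ne (hM : MCS k Δ₀) (h : MCS k Δ) (hE : consEq Δ Δ₀) (h' : MCS k Δ')
    (hE' : consEq Δ' Δ₀) {z : Var} {c d : Cons} (hc : Form.eq (.var z) (.const c) ∈ Δ)
    (hd : Form.eq (.var z) (.const d) ∈ Δ') (hcd : Form.neg (.eq (.const c) (.const d)) ∈ Δ) :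
    canAsg Δ₀ Δ ≠ canAsg Δ₀ Δ' := fun ha =>
  h.false_of_mem_of_neg_mem (h.eq_trans_mem (h.eq_symm_mem hc)
    ((mem_iff_mem_of_canAsg_eq (α := .eq _ _) hM h hE h' hE' ha trivial).2 hd)) hcd

/-- A canonical situation is determined, up to the players' knowledge, by its assignment. -/
lemma CanSit.Kset_eq (hM : MCS k Δ₀) (h₁ : KzEqSet Var.x Var.y Ty ∈ Δ₀)
    (h₂ : KzEqSet Var.y Var.x Tx ∈ Δ₀) (h₃ : Form.eq (Term.var .x) (Term.const cx) ∈ Δ₀)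
    (h₄ : Form.eq (Term.var .y) (Term.const cy) ∈ Δ₀) (hΔ : Δ ∈ CanSit k Δ₀ Ty Tx cx cy)
    (hΔ' : Δ' ∈ CanSit k Δ₀ Ty Tx cx cy) (ha : canAsg Δ₀ Δ = canAsg Δ₀ Δ') (z : Var) :
    Kset z Δ = Kset z Δ' := by
  obtain ⟨h, hE⟩ := mcs_and_consEq hM hΔ
  obtain ⟨h', hE'⟩ := mcs_and_consEq hM hΔ'
  have hT : ∃ T, KzEqSet z z.other T ∈ Δ ∧ KzEqSet z z.other T ∈ Δ' := by
    rcases hΔ with (hΔ | ⟨-, -, hx, hy, c, -, hc, hne⟩) | ⟨-, -, hy, hx, c, -, hc, hne⟩ <;>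
      rcases hΔ' with (hΔ' | ⟨-, -, hx', hy', c', -, hc', hne'⟩) |
        ⟨-, -, hy', hx', c', -, hc', hne'⟩
    · obtain rfl : Δ = Δ₀ := hΔ
      obtain rfl : Δ' = Δ := hΔ'
      cases z
      exacts [⟨Ty, h₁, h₁⟩, ⟨Tx, h₂, h₂⟩]
    · obtain rfl : Δ = Δ₀ := hΔ
      exact absurd ha.symm (canAsg_ne hM h' hE' h hE hc' h₄ hne')
    · obtain rfl : Δ = Δ₀ := hΔ
      exact absurd ha.symm (canAsg_ne hM h' hE' h hE hc' h₃ hne')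
    · obtain rfl : Δ' = Δ₀ := hΔ'
      exact absurd ha (canAsg_ne hM h hE h' hE' hc h₄ hne)
    · cases z
      exacts [⟨Ty, hx, hx'⟩, exists_KzEqSet_mem h hE h' hE' hy hy']
    · exact absurd ha (canAsg_ne hM h hE h' hE' hc (h'.mem_of_K_mem hx') hne)
    · obtain rfl : Δ' = Δ₀ := hΔ'
      exact absurd ha (canAsg_ne hM h hE h' hE' hc h₃ hne)
    · exact absurd ha (canAsg_ne hM h hE h' hE' hc (h'.mem_of_K_mem hy') hne)
    · cases z
      exacts [exists_KzEqSet_mem h hE h' hE' hx hx', ⟨Tx, hy, hy'⟩]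
  obtain ⟨T, hT, hT'⟩ := hT
  exact Kset_eq_of_canAsg_eq hM h hE h' hE' ha hT hT'

lemma canAsg_eq_of_Kset_eq (hM : MCS k Δ₀) (h : MCS k Δ) (hE : consEq Δ Δ₀) (h' : MCS k Δ')
    (hE' : consEq Δ' Δ₀) {z z' : Var} (hK : Kset z Δ = Kset z Δ')
    (hD : canAsg Δ₀ Δ z' ∈ Dball (canI Δ₀) k (canAsg Δ₀ Δ z)) :
    canAsg Δ₀ Δ z' = canAsg Δ₀ Δ' z' := by
  have hd : distForm Pred k (.var z) (.var z') ∈ Δ :=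
    distForm_mem_of_val_mem_Dball hM h hE k hD
  have hKt : Form.Kt z (.var z') ∈ Δ := h.mem_of_prov_imp trivial (.ksight z _) hd
  obtain ⟨c, hc⟩ := h.exists_var_eq_mem z'
  have hKc : Form.eq (.var z') (.const c) ∈ Kset z Δ :=
    ((h.iffF_mem_iff (φ := .Kt _ _) (ψ := .K _ (.eq _ _)) trivial trivial).1 (h.mem_of_prov_imp
      ⟨⟨trivial, trivial⟩, ⟨trivial, trivial⟩⟩ (.deRe z (.var z') c) hc)).1 hKt
  rw [hK] at hKc
  exact ((val_canAsg_eq_iff hM h hE).2 hc).trans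
    ((val_canAsg_eq_iff hM h' hE').2 (h'.mem_of_K_mem hKc)).symm

end Canonical

end

/-- The canonical model is a well-defined `k`-sight model:
the interpretation is independent of the choice of representatives, `I(R)` is
serial, the `∼_z` are equivalence relations, `Σ` is nonempty, every point is
named by a constant, and the `k`-sight condition holds. -/
theorem canonical_is_ksight {Pred Cons : Type} [Fintype Cons] [DecidableEq Cons]
    [Nonempty Cons] (k : ℕ) (Δ₀ : Set (Form Pred Cons)) (Ty Tx : Finset Cons)
    (cx cy : Cons) (hM : MCS k Δ₀)
    (h₁ : KzEqSet Var.x Var.y Ty ∈ Δ₀) (h₂ : KzEqSet Var.y Var.x Tx ∈ Δ₀)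
    (h₃ : Form.eq (Term.var .x) (Term.const cx) ∈ Δ₀)
    (h₄ : Form.eq (Term.var .y) (Term.const cy) ∈ Δ₀) :
    (∀ c₁ c₂ : Cons,
      (canI (Pred := Pred) Δ₀).rel (canConst Δ₀ c₁) (canConst Δ₀ c₂) ↔
        Form.rel (Term.const c₁) (Term.const c₂) ∈ Δ₀) ∧
    (∀ (P : Pred) (cs : List Cons),
      (canI Δ₀).pred P (cs.map (canConst Δ₀)) ↔
        Form.pred P (cs.map Term.const) ∈ Δ₀) ∧
    IsModel (canI Δ₀) (CanSitA k Δ₀ Ty Tx cx cy)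
      (canSim Δ₀ (CanSit k Δ₀ Ty Tx cx cy)) ∧
    KSight k (canI Δ₀) (CanSitA k Δ₀ Ty Tx cx cy)
      (canSim Δ₀ (CanSit k Δ₀ Ty Tx cx cy)) := by
  have hE₀ : consEq Δ₀ Δ₀ := fun _ _ _ => Iff.rfl
  have hrel (c₁ c₂ : Cons) : (canI Δ₀).rel (canConst Δ₀ c₁) (canConst Δ₀ c₂) ↔
      Form.rel (Term.const c₁) (Term.const c₂) ∈ Δ₀ :=
    rel_val_iff hM hM hE₀ (t₁ := .const c₁) (t₂ := .const c₂)
  refine ⟨hrel, pred_canConst_iff hM, ⟨?_, ?_, ?_, ?_, ?_, ?_, ?_⟩, ?_⟩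
  · rintro ⟨_, c, rfl⟩
    obtain ⟨d, hd⟩ := hM.exists_rel_mem c
    exact ⟨canConst Δ₀ d, (hrel c d).2 hd⟩
  · rintro ⟨_, c, rfl⟩
    exact ⟨c, rfl⟩
  · exact ⟨_, Δ₀, .inl (.inl rfl), rfl⟩
  · rintro z _ _ ⟨Δ, hΔ, Δ', hΔ', rfl, rfl, -⟩
    exact ⟨⟨Δ, hΔ, rfl⟩, ⟨Δ', hΔ', rfl⟩⟩
  · rintro z _ ⟨Δ, hΔ, rfl⟩
    exact ⟨Δ, hΔ, Δ, hΔ, rfl, rfl, rfl⟩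
  · rintro z _ _ ⟨Δ, hΔ, Δ', hΔ', rfl, rfl, hK⟩
    exact ⟨Δ', hΔ', Δ, hΔ, rfl, rfl, hK.symm⟩
  · rintro z _ _ _ ⟨Δ, hΔ, Δ', hΔ', rfl, rfl, hK⟩ ⟨Γ, hΓ, Γ', hΓ', ha, rfl, hK'⟩
    exact ⟨Δ, hΔ, Γ', hΓ', rfl, rfl,
      (hK.trans (CanSit.Kset_eq hM h₁ h₂ h₃ h₄ hΔ' hΓ ha z)).trans hK'⟩
  · rintro z _ _ - - ⟨Δ, hΔ, Δ', hΔ', rfl, rfl, hK⟩ z' hD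
    obtain ⟨h, hE⟩ := CanSit.mcs_and_consEq hM hΔ
    obtain ⟨h', hE'⟩ := CanSit.mcs_and_consEq hM hΔ'
    exact canAsg_eq_of_Kset_eq hM h hE h' hE' hK hD
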